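/- The set WI of weakly irreducible bases is uncountable. -/

import Mathlib

open Classical

/-- The one-sided shift map on sequences. -/
def shift (x : ℕ → ℕ) : ℕ → ℕ := fun i => x (i + 1)

/-- Reflection of a sequence with respect to the alphabet `{0,…,M}`. -/
def reflSeq (M : ℕ) (x : ℕ → ℕ) : ℕ → ℕ := fun i => M - x i

/-- Strict lexicographic order on sequences. -/
def lexLT (x y : ℕ → ℕ) : Prop := ∃ n : ℕ, (∀ i < n, x i = y i) ∧ x n < y n

/-- Lexicographic order on sequences. -/
def lexLE (x y : ℕ → ℕ) : Prop := x = y ∨ lexLT x y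

/-- Strict lexicographic order on words (of the same length). -/
def wordLT (u v : List ℕ) : Prop :=
  ∃ n : ℕ, n < u.length ∧ (∀ i < n, u.getD i 0 = v.getD i 0) ∧ u.getD n 0 < v.getD n 0

/-- Lexicographic order on words (of the same length). -/
def wordLE (u v : List ℕ) : Prop := u = v ∨ wordLT u v

/-- Membership in the full shift over the alphabet `{0,…,M}`. -/
def memSigma (M : ℕ) (x : ℕ → ℕ) : Prop := ∀ i, x i ≤ M

/-- `a` is the quasi-greedy expansion of `1` in base `q` over the alphabet `{0,…,M}`:
the lexicographically largest sequence with infinitely many nonzero entries satisfying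
`∑ a_i q^{-i} = 1`. -/
def IsQuasiGreedy (M : ℕ) (q : ℝ) (a : ℕ → ℕ) : Prop :=
  memSigma M a ∧ (∀ n, ∃ m ≥ n, a m ≠ 0) ∧ (∑' i : ℕ, (a i : ℝ) / q ^ (i + 1)) = 1 ∧
    ∀ b : ℕ → ℕ, memSigma M b → (∀ n, ∃ m ≥ n, b m ≠ 0) →
      (∑' i : ℕ, (b i : ℝ) / q ^ (i + 1)) = 1 → lexLE b a

/-- The quasi-greedy expansion of `1` in base `q` (as a global function, via choice). -/
noncomputable def qg (M : ℕ) (q : ℝ) : ℕ → ℕ :=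
  if h : ∃ a, IsQuasiGreedy M q a then h.choose else fun _ => 0

/-- The set `V` of sequences `a` with `ā ≼ σⁿ(a) ≼ a` for all `n ≥ 0`. -/
def memV (M : ℕ) (a : ℕ → ℕ) : Prop :=
  memSigma M a ∧ ∀ n : ℕ, lexLE (reflSeq M a) (shift^[n] a) ∧ lexLE (shift^[n] a) a

/-- The set `V_L` of bases `q ∈ (1, M+1]` with `α(q) ∈ V`. -/
def memVL (M : ℕ) (q : ℝ) : Prop := 1 < q ∧ q ≤ M + 1 ∧ memV M (qg M q)

/-- The symmetric `q`-shift `V_q`. -/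
def Vq (M : ℕ) (q : ℝ) : Set (ℕ → ℕ) :=
  {x | memSigma M x ∧
    ∀ n : ℕ, lexLE (reflSeq M (qg M q)) (shift^[n] x) ∧ lexLE (shift^[n] x) (qg M q)}

/-- The word `w` occurs as a factor of the sequence `x`. -/
def IsFactorOf (w : List ℕ) (x : ℕ → ℕ) : Prop :=
  ∃ k : ℕ, ∀ i < w.length, x (k + i) = w.getD i 0

/-- Membership in the language of a subshift `X`. -/
def InLang (X : Set (ℕ → ℕ)) (w : List ℕ) : Prop := ∃ x ∈ X, IsFactorOf w x

/-- The set of admissible words of length `k` of a subshift `X`. -/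
def Bn (X : Set (ℕ → ℕ)) (k : ℕ) : Set (List ℕ) := {w | w.length = k ∧ InLang X w}

/-- The specification property. -/
def HasSpecification (X : Set (ℕ → ℕ)) : Prop :=
  ∃ S : ℕ, ∀ u v : List ℕ, InLang X u → InLang X v →
    ∃ w : List ℕ, w.length = S ∧ InLang X (u ++ w ++ v)

/-- Topological transitivity (language formulation). -/
def IsTransitive (X : Set (ℕ → ℕ)) : Prop :=
  ∀ u v : List ℕ, InLang X u → InLang X v → ∃ w : List ℕ, InLang X (u ++ w ++ v)

/-- Topological mixing (language formulation). -/
def IsMixing (X : Set (ℕ → ℕ)) : Prop :=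
  ∀ u v : List ℕ, InLang X u → InLang X v →
    ∃ N : ℕ, ∀ n ≥ N, ∃ w : List ℕ, w.length = n ∧ InLang X (u ++ w ++ v)

/-- Intrinsically synchronising word. -/
def IntrinsicallySynchronising (X : Set (ℕ → ℕ)) (w : List ℕ) : Prop :=
  ∀ u v : List ℕ, InLang X (u ++ w) → InLang X (w ++ v) → InLang X (u ++ w ++ v)

/-- Synchronised subshift: transitive with an intrinsically synchronising word. -/
def IsSynchronised (X : Set (ℕ → ℕ)) : Prop :=
  IsTransitive X ∧ ∃ w : List ℕ, InLang X w ∧ IntrinsicallySynchronising X w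

/-- Subshift of finite type over `{0,…,M}`: determined by a finite set of forbidden words. -/
def IsSFT (M : ℕ) (X : Set (ℕ → ℕ)) : Prop :=
  ∃ F : Finset (List ℕ), X = {x | memSigma M x ∧ ∀ w ∈ F, ¬ IsFactorOf w x}

/-- Coded system: the closure of an increasing union of transitive subshifts of finite type. -/
def IsCoded (M : ℕ) (X : Set (ℕ → ℕ)) : Prop :=
  ∃ Y : ℕ → Set (ℕ → ℕ), (∀ n, IsSFT M (Y n) ∧ IsTransitive (Y n)) ∧
    (∀ n, Y n ⊆ Y (n + 1)) ∧ X = closure (⋃ n, Y n)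

/-- `ω⁻`: decrease the last letter of a word by one. -/
def wMinus (w : List ℕ) : List ℕ := w.dropLast ++ [w.getLast! - 1]

/-- `ω⁺`: increase the last letter of a word by one. -/
def wPlus (w : List ℕ) : List ℕ := w.dropLast ++ [w.getLast! + 1]

/-- Reflection of a word. -/
def wRefl (M : ℕ) (w : List ℕ) : List ℕ := w.map (fun c => M - c)

/-- `ω^∞`: the periodic sequence repeating the word `w`. -/
def perSeq (w : List ℕ) : ℕ → ℕ := fun i => w.getD (i % w.length) 0

/-- The sequence beginning with the word `u` followed by the periodic sequence `v^∞`. -/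
def wordThenPer (u v : List ℕ) : ℕ → ℕ :=
  fun i => if i < u.length then u.getD i 0 else perSeq v (i - u.length)

/-- The prefix of length `n` of a sequence, as a word. -/
def prefixWord (a : ℕ → ℕ) (n : ℕ) : List ℕ := (List.range n).map a

/-- A sequence `a ∈ V` is irreducible if `a_1…a_j (\overline{a_1…a_j}⁺)^∞ ≺ a`
whenever `(a_1…a_j⁻)^∞ ∈ V`. -/
def IrreducibleSeq (M : ℕ) (a : ℕ → ℕ) : Prop :=
  ∀ j : ℕ, 1 ≤ j → memV M (perSeq (wMinus (prefixWord a j))) →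
    lexLT (wordThenPer (prefixWord a j) (wPlus (wRefl M (prefixWord a j)))) a

/-- The set `I` of irreducible bases. -/
def memI (M : ℕ) (q : ℝ) : Prop := memVL M q ∧ IrreducibleSeq M (qg M q)

/-- The set `U` of univoque bases. -/
def memU (M : ℕ) (q : ℝ) : Prop :=
  (1 < q ∧ q < M + 1 ∧ ∀ n : ℕ, 1 ≤ n →
      lexLT (reflSeq M (qg M q)) (shift^[n] (qg M q)) ∧
        lexLT (shift^[n] (qg M q)) (qg M q)) ∨ q = M + 1

/-- The set `U̅`: closure of the set of univoque bases. -/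
def memUbar (M : ℕ) (q : ℝ) : Prop :=
  1 < q ∧ q ≤ M + 1 ∧
    ∀ n : ℕ, lexLT (reflSeq M (qg M q)) (shift^[n] (qg M q)) ∧
      lexLE (shift^[n] (qg M q)) (qg M q)

/-- The indices `n_m` of the natural approximation from below (`approxIdx M q 0 = n_1`). -/
noncomputable def approxIdx (M : ℕ) (q : ℝ) : ℕ → ℕ
  | 0 => sInf {n : ℕ | 1 ≤ n ∧ memV M (perSeq (wMinus (prefixWord (qg M q) n)))}
  | m + 1 => sInf {n : ℕ | approxIdx M q m < n ∧ memV M (perSeq (wMinus (prefixWord (qg M q) n)))}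

/-- The base in `(1, M+1]` whose quasi-greedy expansion is `a` (via choice). -/
noncomputable def baseOf (M : ℕ) (a : ℕ → ℕ) : ℝ :=
  if h : ∃ q : ℝ, 1 < q ∧ q ≤ M + 1 ∧ qg M q = a then h.choose else 0

/-- The natural approximation from below of `q` (`approxBase M q 0 = q_1⁻`),
determined by `α(q_m⁻) = (α_1(q)…α_{n_m}(q)⁻)^∞`. -/
noncomputable def approxBase (M : ℕ) (q : ℝ) (m : ℕ) : ℝ :=
  baseOf M (perSeq (wMinus (prefixWord (qg M q) (approxIdx M q m))))

/-- Strongly irreducible base: `q ∈ I` and all but finitely many terms of the natural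
approximation from below lie in `I`. -/
def memSI (M : ℕ) (q : ℝ) : Prop :=
  memI M q ∧ ∃ N : ℕ, ∀ m ≥ N, memI M (approxBase M q m)

/-- Weakly irreducible base: `q ∈ I` but infinitely many terms of the natural
approximation from below are not in `I`. -/
def memWI (M : ℕ) (q : ℝ) : Prop :=
  memI M q ∧ ∀ N : ℕ, ∃ m ≥ N, ¬ memI M (approxBase M q m)

/-- The generalised golden ratio `q_G(M)`. -/
noncomputable def qG (M : ℕ) : ℝ :=
  if M % 2 = 0 then ((M / 2 : ℕ) : ℝ) + 1
  else (((M / 2 : ℕ) : ℝ) + 1 +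
    Real.sqrt (((M / 2 : ℕ) : ℝ) ^ 2 + 6 * ((M / 2 : ℕ) : ℝ) + 5)) / 2

/-- The metric on `Σ_M`: `d(x,y) = 2^{-j}` where `j` is the first (1-indexed) place
where `x` and `y` differ. -/
noncomputable def seqDist (x y : ℕ → ℕ) : ℝ :=
  if x = y then 0 else (1 / 2 : ℝ) ^ (sInf {i : ℕ | x i ≠ y i} + 1)

/-- Fundamental word (Allaart). -/
def IsFundamentalWord (M : ℕ) (w : List ℕ) : Prop :=
  2 < w.length ∧ ∀ i : ℕ, 1 ≤ i → i ≤ w.length - 1 →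
    wordLE (wRefl M (w.take (w.length - i))) (w.drop i) ∧
      wordLT (w.drop i) (w.take (w.length - i))

/-- The set `I_N`. -/
def memIN (M N : ℕ) (q : ℝ) : Prop :=
  memVL M q ∧
    prefixWord (qg M q) (2 * N) = List.replicate (2 * N - 1) M ++ [0] ∧
    ∀ r : ℕ, 2 ≤ r →
      wordLT (List.replicate N 0) ((List.range N).map (fun i => qg M q (r * N + i))) ∧
      wordLT ((List.range N).map (fun i => qg M q (r * N + i))) (List.replicate N M)

/-- The (forward) orbit of a sequence under the shift. -/
def orbit (a : ℕ → ℕ) : Set (ℕ → ℕ) := {y | ∃ n : ℕ, y = shift^[n] a}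


lemma shift_iterate_apply (n : ℕ) (x : ℕ → ℕ) (i : ℕ) : shift^[n] x i = x (n + i) := by
  induction n generalizing x with
  | zero => simp
  | succ n ih =>
    rw [Function.iterate_succ_apply, ih]
    simp only [shift]
    congr 1
    omega

lemma lexLT_of_not_lexLE {x y : ℕ → ℕ} (h : ¬ lexLE x y) : lexLT y x := by
  have hne : ∃ i, x i ≠ y i := by
    by_contra hcon
    push Not at hcon
    exact h (Or.inl (funext hcon))
  have hmin : ∀ i < Nat.find hne, x i = y i := fun i hi => not_not.mp (Nat.find_min hne hi)
  refine ⟨Nat.find hne, fun i hi => (hmin i hi).symm, ?_⟩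
  rcases lt_or_gt_of_ne (Nat.find_spec hne) with hlt | hgt
  · exact absurd (Or.inr ⟨_, hmin, hlt⟩) h
  · exact hgt

lemma lexLT_asymm {x y : ℕ → ℕ} (h : lexLT x y) : ¬ lexLT y x := by
  obtain ⟨m, hm, hlt⟩ := h
  rintro ⟨n, hn, hgt⟩
  rcases lt_trichotomy m n with hmn | hmn | hmn
  · have := hn m hmn
    omega
  · subst hmn
    omega
  · have := hm n hmn
    omega

lemma lexLE_antisymm {x y : ℕ → ℕ} (h₁ : lexLE x y) (h₂ : lexLE y x) : x = y := by
  rcases h₁ with h₁ | h₁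
  · exact h₁
  · rcases h₂ with h₂ | h₂
    · exact h₂.symm
    · exact absurd h₂ (lexLT_asymm h₁)

/-! ### Existence of a base with prescribed quasi-greedy expansion -/

/-- The value of the sequence `x` in base `q`. -/
noncomputable def baseValue (q : ℝ) (x : ℕ → ℕ) : ℝ := ∑' i : ℕ, (x i : ℝ) / q ^ (i + 1)

lemma summable_const_div_pow (C : ℝ) {q : ℝ} (hq : 1 < q) :
    Summable fun i : ℕ => C / q ^ (i + 1) := by
  have h : Summable fun i : ℕ => (C / q) * q⁻¹ ^ i :=
    (summable_geometric_of_lt_one (by positivity) (inv_lt_one_of_one_lt₀ hq)).mul_left _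
  refine h.congr fun i => ?_
  rw [pow_succ, inv_pow]
  field_simp

lemma summable_digits {M : ℕ} {x : ℕ → ℕ} (hx : memSigma M x) {q : ℝ} (hq : 1 < q) :
    Summable fun i : ℕ => (x i : ℝ) / q ^ (i + 1) := by
  refine Summable.of_nonneg_of_le (fun i => by positivity) (fun i => ?_)
    (summable_const_div_pow M hq)
  have : (x i : ℝ) ≤ M := by exact_mod_cast hx i
  gcongr

lemma baseValue_le {M : ℕ} {x : ℕ → ℕ} (hx : memSigma M x) {q : ℝ} (hq : 1 < q) :
    baseValue q x ≤ ∑' i : ℕ, (M : ℝ) / q ^ (i + 1) := by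
  refine Summable.tsum_le_tsum (fun i => ?_) (summable_digits hx hq) (summable_const_div_pow M hq)
  have : (x i : ℝ) ≤ M := by exact_mod_cast hx i
  gcongr

lemma baseValue_split {M : ℕ} {x : ℕ → ℕ} (hx : memSigma M x) {q : ℝ} (hq : 1 < q) (n : ℕ) :
    baseValue q x = ∑ i ∈ Finset.range n, (x i : ℝ) / q ^ (i + 1)
      + baseValue q (fun i => x (n + i)) / q ^ n := by
  unfold baseValue
  rw [← (summable_digits hx hq).sum_add_tsum_nat_add n, ← tsum_div_const]
  congr 1
  refine tsum_congr fun i => ?_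
  rw [div_div, ← pow_add, add_comm i n]
  congr 2
  omega

lemma baseValue_nonneg {q : ℝ} (hq : 1 < q) (x : ℕ → ℕ) : 0 ≤ baseValue q x :=
  tsum_nonneg fun i => by positivity

lemma baseValue_pos {M : ℕ} {x : ℕ → ℕ} (hx : memSigma M x) {q : ℝ} (hq : 1 < q) {i : ℕ}
    (hi : x i ≠ 0) : 0 < baseValue q x := by
  refine (summable_digits hx hq).tsum_pos (fun i => by positivity) i ?_
  have : (0 : ℝ) < x i := by exact_mod_cast Nat.pos_of_ne_zero hi
  positivity

lemma baseValue_tail_le_one {M : ℕ} {x : ℕ → ℕ} (hx : memSigma M x)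
    (hmax : ∀ n, lexLE (shift^[n] x) x) {q : ℝ} (hq : 1 < q) (hval : baseValue q x = 1) (n : ℕ) :
    baseValue q (fun i => x (n + i)) ≤ 1 := by
  set C : ℝ := ∑' i : ℕ, (M : ℝ) / q ^ (i + 1)
  have hC : 0 ≤ C := tsum_nonneg fun i => by positivity
  have key : ∀ j n : ℕ, baseValue q (fun i => x (n + i)) ≤ 1 + C / q ^ j := by
    intro j
    induction j with
    | zero =>
      intro n
      have := baseValue_le (x := fun i => x (n + i)) (fun i => hx _) hq
      simp only [pow_zero, div_one]
      linarith
    | succ j ih =>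
      intro n
      have hCj : 0 ≤ C / q ^ (j + 1) := by positivity
      rcases hmax n with heq | ⟨d, hd, hlt⟩
      · have : (fun i => x (n + i)) = x :=
          (funext fun i => (shift_iterate_apply n x i).symm).trans heq
        rw [this, hval]
        linarith
      · simp only [shift_iterate_apply] at hd hlt
        have hs := baseValue_split (x := fun i => x (n + i)) (fun i => hx _) hq (d + 1)
        have hsx := baseValue_split hx hq (d + 1)
        rw [Finset.sum_range_succ] at hs hsx
        rw [Finset.sum_congr rfl (fun i hi => by rw [hd i (Finset.mem_range.mp hi)])] at hs
        have htail := ih (n + (d + 1))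
        have hnn := baseValue_nonneg hq (fun i => x (d + 1 + i))
        have hqd : 0 < q ^ (d + 1) := by positivity
        have hdig : (x (n + d) : ℝ) / q ^ (d + 1) ≤ x d / q ^ (d + 1) - 1 / q ^ (d + 1) := by
          rw [← sub_div]
          have : (x (n + d) : ℝ) + 1 ≤ x d := by exact_mod_cast hlt
          gcongr
          linarith
        have h1 : baseValue q (fun i => x (n + (d + 1 + i))) / q ^ (d + 1)
            ≤ 1 / q ^ (d + 1) + C / q ^ j / q ^ (d + 1) := by
          rw [← add_div]
          gcongr
          simpa [add_assoc] using htail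
        have h2 : C / q ^ j / q ^ (d + 1) ≤ C / q ^ (j + 1) := by
          rw [div_div, ← pow_add]
          have : q ^ (j + 1) ≤ q ^ (j + (d + 1)) := pow_le_pow_right₀ hq.le (by omega)
          gcongr
        have h3 : 0 ≤ baseValue q (fun i => x (d + 1 + i)) / q ^ (d + 1) := by positivity
        rw [hval] at hsx
        linarith
  have hlim : Filter.Tendsto (fun j : ℕ => 1 + C / q ^ j) Filter.atTop (nhds (1 + 0)) :=
    tendsto_const_nhds.add
      (tendsto_const_nhds.div_atTop (tendsto_pow_atTop_atTop_of_one_lt hq))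
  rw [add_zero] at hlim
  exact ge_of_tendsto' hlim fun j => key j n

lemma isQuasiGreedy_of_baseValue_eq_one {M : ℕ} {x : ℕ → ℕ} (hx : memSigma M x)
    (hinf : ∀ n, ∃ m ≥ n, x m ≠ 0) (hmax : ∀ n, lexLE (shift^[n] x) x) {q : ℝ} (hq : 1 < q)
    (hval : baseValue q x = 1) : IsQuasiGreedy M q x := by
  refine ⟨hx, hinf, hval, fun b hb hbinf hbval => ?_⟩
  by_contra hcon
  obtain ⟨n, hn, hlt⟩ := lexLT_of_not_lexLE hcon
  have hbs := baseValue_split hb hq (n + 1)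
  have hxs := baseValue_split hx hq (n + 1)
  rw [Finset.sum_range_succ] at hbs hxs
  rw [Finset.sum_congr rfl (fun i hi => by rw [hn i (Finset.mem_range.mp hi)]), hval] at hxs
  obtain ⟨m, hm, hbm⟩ := hbinf (n + 1)
  have hpos : 0 < baseValue q (fun i => b (n + 1 + i)) :=
    baseValue_pos (fun i => hb _) hq (i := m - (n + 1)) (by
      rwa [Nat.add_sub_cancel' hm])
  have hqn : 0 < q ^ (n + 1) := by positivity
  have h1 : 0 < baseValue q (fun i => b (n + 1 + i)) / q ^ (n + 1) := by positivity
  have h2 : baseValue q (fun i => x (n + 1 + i)) / q ^ (n + 1) ≤ 1 / q ^ (n + 1) := by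
    have := baseValue_tail_le_one hx hmax hq hval (n + 1)
    gcongr
  have h3 : (x n : ℝ) / q ^ (n + 1) + 1 / q ^ (n + 1) ≤ b n / q ^ (n + 1) := by
    rw [← add_div]
    have : (x n : ℝ) + 1 ≤ b n := by exact_mod_cast hlt
    gcongr
  have h4 : baseValue q b = 1 := hbval
  linarith

lemma IsQuasiGreedy.qg_eq {M : ℕ} {q : ℝ} {x : ℕ → ℕ} (h : IsQuasiGreedy M q x) :
    qg M q = x := by
  have hex : ∃ a, IsQuasiGreedy M q a := ⟨x, h⟩
  have hc := hex.choose_spec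
  rw [qg, dif_pos hex]
  exact lexLE_antisymm (h.2.2.2 _ hc.1 hc.2.1 hc.2.2.1) (hc.2.2.2 _ h.1 h.2.1 h.2.2.1)

lemma exists_baseValue_eq_one {M : ℕ} (hM : 1 ≤ M) {x : ℕ → ℕ} (hx : memSigma M x)
    (h0 : x 0 ≠ 0) (h1 : x 1 ≠ 0) : ∃ q : ℝ, 1 < q ∧ q ≤ M + 1 ∧ baseValue q x = 1 := by
  have hM' : (1 : ℝ) ≤ M := by exact_mod_cast hM
  have hcont : ContinuousOn (fun q : ℝ => baseValue q x) (Set.Icc (3 / 2) (M + 1)) := by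
    refine continuousOn_tsum (u := fun i : ℕ => (M : ℝ) / (3 / 2) ^ (i + 1)) (fun i => ?_)
      (summable_const_div_pow M (by norm_num)) (fun i q hq => ?_)
    · refine continuousOn_const.div (by fun_prop) fun q hq => ?_
      have : 0 < q := by linarith [hq.1]
      positivity
    · have hq0 : 0 < q := by linarith [hq.1]
      have hxi : (x i : ℝ) ≤ M := by exact_mod_cast hx i
      rw [Real.norm_of_nonneg (by positivity)]
      have := hq.1
      gcongr
  have hlow : 1 ≤ baseValue (3 / 2) x := by
    rw [baseValue_split hx (by norm_num) 2, Finset.sum_range_succ, Finset.sum_range_one]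
    have hnn := baseValue_nonneg (q := 3 / 2) (by norm_num) (fun i => x (2 + i))
    have e0 : (1 : ℝ) ≤ x 0 := by exact_mod_cast Nat.one_le_iff_ne_zero.mpr h0
    have e1 : (1 : ℝ) ≤ x 1 := by exact_mod_cast Nat.one_le_iff_ne_zero.mpr h1
    have : 0 ≤ baseValue (3 / 2) (fun i => x (2 + i)) / (3 / 2 : ℝ) ^ 2 := by positivity
    norm_num at this ⊢
    linarith
  have hhigh : baseValue (M + 1) x ≤ 1 := by
    refine (baseValue_le hx (by linarith)).trans (le_of_eq ?_)
    have hr : (M + 1 : ℝ)⁻¹ < 1 := inv_lt_one_of_one_lt₀ (by linarith)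
    have hterm : ∀ i : ℕ, (M : ℝ) / (M + 1) ^ (i + 1) = (M / (M + 1)) * (M + 1 : ℝ)⁻¹ ^ i := by
      intro i
      rw [pow_succ, inv_pow]
      field_simp
    rw [tsum_congr hterm, tsum_mul_left, tsum_geometric_of_lt_one (by positivity) hr]
    have : (M + 1 : ℝ) ≠ 0 := by positivity
    have : (1 - (M + 1 : ℝ)⁻¹) = M / (M + 1) := by field_simp; ring
    rw [this]
    field_simp
  obtain ⟨q, hq, hqv⟩ := intermediate_value_Icc' (by linarith) hcont ⟨hhigh, hlow⟩
  exact ⟨q, by linarith [hq.1], hq.2, hqv⟩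

lemma exists_base_qg_eq {M : ℕ} (hM : 1 ≤ M) {x : ℕ → ℕ} (hx : memSigma M x)
    (h0 : x 0 ≠ 0) (h1 : x 1 ≠ 0) (hinf : ∀ n, ∃ m ≥ n, x m ≠ 0)
    (hmax : ∀ n, lexLE (shift^[n] x) x) : ∃ q : ℝ, 1 < q ∧ q ≤ M + 1 ∧ qg M q = x := by
  obtain ⟨q, hq, hqM, hval⟩ := exists_baseValue_eq_one hM hx h0 h1
  exact ⟨q, hq, hqM, (isQuasiGreedy_of_baseValue_eq_one hx hinf hmax hq hval).qg_eq⟩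

/-! ### The natural approximation from below -/

/-- The indices at which the natural approximation from below truncates `α(q)`. -/
def approxSet (M : ℕ) (q : ℝ) : Set ℕ :=
  {n | 1 ≤ n ∧ memV M (perSeq (wMinus (prefixWord (qg M q) n)))}

lemma approxIdx_lt_succ {M : ℕ} {q : ℝ} (hinf : ∀ N, ∃ n ∈ approxSet M q, N < n) (m : ℕ) :
    approxIdx M q m < approxIdx M q (m + 1) := by
  obtain ⟨n, hn, hlt⟩ := hinf (approxIdx M q m)
  exact (Nat.sInf_mem (s := {n : ℕ | approxIdx M q m < n ∧
    memV M (perSeq (wMinus (prefixWord (qg M q) n)))}) ⟨n, hlt, hn.2⟩).1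

lemma exists_approxIdx_eq_of_lt {M : ℕ} {q : ℝ} {n : ℕ} (hn : n ∈ approxSet M q) (m : ℕ)
    (hlt : n < approxIdx M q m) : ∃ m', approxIdx M q m' = n := by
  induction m with
  | zero => exact absurd (Nat.sInf_le hn) (not_le.mpr hlt)
  | succ m ih =>
    rcases lt_trichotomy n (approxIdx M q m) with h | h | h
    · exact ih h
    · exact ⟨m, h.symm⟩
    · exact absurd (Nat.sInf_le (s := {n : ℕ | approxIdx M q m < n ∧
        memV M (perSeq (wMinus (prefixWord (qg M q) n)))}) ⟨h, hn.2⟩) (not_le.mpr hlt)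

lemma irreducibleSeq_of_memI_baseOf {M : ℕ} {x : ℕ → ℕ} (h : memI M (baseOf M x)) :
    IrreducibleSeq M x := by
  by_cases hex : ∃ q : ℝ, 1 < q ∧ q ≤ M + 1 ∧ qg M q = x
  · have hb : baseOf M x = hex.choose := dif_pos hex
    have := h.2
    rwa [hb, hex.choose_spec.2.2] at this
  · have hb : baseOf M x = 0 := dif_neg hex
    have := h.1.1
    rw [hb] at this
    norm_num at this

lemma memWI_of_infinitely_many_reducible {M : ℕ} {q : ℝ} (hI : memI M q)
    (h : ∀ N, ∃ n ∈ approxSet M q, N < n ∧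
      ¬ IrreducibleSeq M (perSeq (wMinus (prefixWord (qg M q) n)))) : memWI M q := by
  refine ⟨hI, fun N => ?_⟩
  have hmono : StrictMono (approxIdx M q) := strictMono_nat_of_lt_succ <|
    approxIdx_lt_succ fun N => let ⟨n, hn, hlt, _⟩ := h N; ⟨n, hn, hlt⟩
  obtain ⟨n, hn, hlt, hred⟩ := h (approxIdx M q N)
  obtain ⟨m, hm⟩ := exists_approxIdx_eq_of_lt hn (n + 1) (hmono.le_apply (x := n + 1))
  refine ⟨m, (hmono.lt_iff_lt.mp (hm ▸ hlt)).le, fun hmem => hred ?_⟩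
  rw [approxBase, hm] at hmem
  exact irreducibleSeq_of_memI_baseOf hmem

/-! ### Words as functions -/

lemma perSeq_wMinus_prefixWord (x : ℕ → ℕ) {n : ℕ} (hn : 1 ≤ n) (i : ℕ) :
    perSeq (wMinus (prefixWord x n)) i
      = if i % n = n - 1 then x (n - 1) - 1 else x (i % n) := by
  obtain ⟨n, rfl⟩ := Nat.exists_eq_succ_of_ne_zero (Nat.one_le_iff_ne_zero.mp hn)
  have hw : wMinus (prefixWord x (n + 1)) = (List.range n).map x ++ [x n - 1] := by
    simp [wMinus, prefixWord, List.range_succ, List.getLast!_eq_getLast?_getD]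
  have hlt : i % (n + 1) < n + 1 := Nat.mod_lt _ (by omega)
  simp only [Nat.succ_eq_add_one, perSeq, hw, List.length_append, List.length_map,
    List.length_range, List.length_singleton, Nat.add_sub_cancel]
  split_ifs with h
  · rw [h]
    simp [List.getD_eq_getElem?_getD]
  · rw [List.getD_append _ _ _ _ (by simp; omega)]
    have : i % (n + 1) < n := by omega
    simp [List.getD_eq_getElem?_getD, this]

lemma wordThenPer_prefixWord (M : ℕ) (x : ℕ → ℕ) {n : ℕ} (hn : 1 ≤ n) (i : ℕ) :
    wordThenPer (prefixWord x n) (wPlus (wRefl M (prefixWord x n))) i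
      = if i < n then x i else
        if (i - n) % n = n - 1 then M - x (n - 1) + 1 else M - x ((i - n) % n) := by
  obtain ⟨n, rfl⟩ := Nat.exists_eq_succ_of_ne_zero (Nat.one_le_iff_ne_zero.mp hn)
  have hw : wPlus (wRefl M (prefixWord x (n + 1)))
      = (List.range n).map (fun i => M - x i) ++ [M - x n + 1] := by
    simp [wPlus, wRefl, prefixWord, List.range_succ, List.getLast!_eq_getLast?_getD]
  have hlen : (prefixWord x (n + 1)).length = n + 1 := by simp [prefixWord]
  have hlt : (i - (n + 1)) % (n + 1) < n + 1 := Nat.mod_lt _ (by omega)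
  simp only [Nat.succ_eq_add_one, wordThenPer, hlen]
  split_ifs with h1 h2
  · simp [prefixWord, List.getD_eq_getElem?_getD, h1]
  · simp only [perSeq, hw, List.length_append, List.length_map,
      List.length_range, List.length_singleton, h2]
    simp [List.getD_eq_getElem?_getD]
  · simp only [perSeq, hw, List.length_append, List.length_map,
      List.length_range, List.length_singleton]
    rw [List.getD_append _ _ _ _ (by simp; omega)]
    have : (i - (n + 1)) % (n + 1) < n := by omega
    simp [List.getD_eq_getElem?_getD, this]

/-! ### Strict domination of shifts within a finite window -/

/-- Within its first `N` letters, the sequence `x` shows that both its shift by `n` and the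
reflection of that shift are strictly smaller than `x`. -/
def Dominated (M : ℕ) (x : ℕ → ℕ) (n N : ℕ) : Prop :=
  (∃ d, n + d < N ∧ (∀ e < d, x (n + e) = x e) ∧ x (n + d) < x d) ∧
    ∃ d, n + d < N ∧ (∀ e < d, M - x (n + e) = x e) ∧ M - x (n + d) < x d

namespace Dominated

variable {M : ℕ} {x y : ℕ → ℕ} {n N N' : ℕ}

lemma mono (h : Dominated M x n N) (hN : N ≤ N') : Dominated M x n N' := by
  obtain ⟨⟨d, hd, h1⟩, ⟨d', hd', h2⟩⟩ := h
  exact ⟨⟨d, by omega, h1⟩, ⟨d', by omega, h2⟩⟩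

lemma copy {p : ℕ} (h : Dominated M x n N) (hy : ∀ i < N, y i = x i)
    (hp : ∀ i < N, y (p + i) = x i) : Dominated M y (p + n) (p + N) := by
  obtain ⟨⟨d, hd, h1, h1'⟩, ⟨d', hd', h2, h2'⟩⟩ := h
  refine ⟨⟨d, by omega, fun e he => ?_, ?_⟩, ⟨d', by omega, fun e he => ?_, ?_⟩⟩
  · rw [add_assoc, hp _ (by omega), hy _ (by omega), h1 e he]
  · rwa [add_assoc, hp _ (by omega), hy _ (by omega)]
  · rw [add_assoc, hp _ (by omega), hy _ (by omega), h2 e he]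
  · rwa [add_assoc, hp _ (by omega), hy _ (by omega)]

lemma congr (h : Dominated M x n N) (hy : ∀ i < N, y i = x i) : Dominated M y n N := by
  simpa using h.copy (p := 0) hy (by simpa using hy)

lemma reflect {p : ℕ} (h : Dominated M x n N) (hx : memSigma M x) (hy : ∀ i < N, y i = x i)
    (hp : ∀ i < N, y (p + i) = M - x i) : Dominated M y (p + n) (p + N) := by
  obtain ⟨⟨d, hd, h1, h1'⟩, ⟨d', hd', h2, h2'⟩⟩ := h
  refine ⟨⟨d', by omega, fun e he => ?_, ?_⟩, ⟨d, by omega, fun e he => ?_, ?_⟩⟩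
  · rw [add_assoc, hp _ (by omega), hy _ (by omega), h2 e he]
  · rwa [add_assoc, hp _ (by omega), hy _ (by omega)]
  · rw [add_assoc, hp _ (by omega), hy _ (by omega), Nat.sub_sub_self (hx _), h1 e he]
  · rwa [add_assoc, hp _ (by omega), hy _ (by omega), Nat.sub_sub_self (hx _)]

/-- A window of at most three letters suffices if `x` starts with `M M M` and the letters
after position `n` are neither `M M M` nor `0 0 0`. -/
lemma of_short (h0 : x 0 = M) (h1 : x 1 = M) (h2 : x 2 = M)
    (hlt : n < N ∧ x n < M ∨ n + 1 < N ∧ x n = M ∧ x (n + 1) < M ∨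
      n + 2 < N ∧ x n = M ∧ x (n + 1) = M ∧ x (n + 2) < M)
    (hgt : n < N ∧ M ≠ 0 ∧ 0 < x n ∨ n + 1 < N ∧ M ≠ 0 ∧ x n = 0 ∧ 0 < x (n + 1) ∨
      n + 2 < N ∧ M ≠ 0 ∧ x n = 0 ∧ x (n + 1) = 0 ∧ 0 < x (n + 2)) : Dominated M x n N := by
  constructor
  · rcases hlt with ⟨hN, h⟩ | ⟨hN, ha, h⟩ | ⟨hN, ha, hb, h⟩
    · exact ⟨0, hN, by simp, by simpa [h0] using h⟩
    · refine ⟨1, hN, fun e he => ?_, by simpa [h1] using h⟩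
      obtain rfl : e = 0 := by omega
      simpa [h0] using ha
    · refine ⟨2, hN, fun e he => ?_, by simpa [h2] using h⟩
      obtain rfl | rfl : e = 0 ∨ e = 1 := by omega
      · simpa [h0] using ha
      · simpa [h1] using hb
  · rcases hgt with ⟨hN, hM, h⟩ | ⟨hN, hM, ha, h⟩ | ⟨hN, hM, ha, hb, h⟩
    · exact ⟨0, hN, by simp, by simp only [add_zero, h0]; omega⟩
    · refine ⟨1, hN, fun e he => ?_, by rw [h1]; omega⟩
      obtain rfl : e = 0 := by omega
      simp [h0, ha]
    · refine ⟨2, hN, fun e he => ?_, by rw [h2]; omega⟩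
      obtain rfl | rfl : e = 0 ∨ e = 1 := by omega
      · simp [h0, ha]
      · simp [h1, hb]

lemma shift_lexLT (h : Dominated M x n N) : lexLT (shift^[n] x) x := by
  obtain ⟨⟨d, -, h1, h2⟩, -⟩ := h
  exact ⟨d, fun e he => by rw [shift_iterate_apply, h1 e he], by rwa [shift_iterate_apply]⟩

lemma reflSeq_shift_lexLT (h : Dominated M x n N) : lexLT (reflSeq M (shift^[n] x)) x := by
  obtain ⟨-, ⟨d, -, h1, h2⟩⟩ := h
  refine ⟨d, fun e he => ?_, ?_⟩
  · rw [reflSeq, shift_iterate_apply, h1 e he]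
  · rwa [reflSeq, shift_iterate_apply]

end Dominated

lemma reflSeq_reflSeq {M : ℕ} {x : ℕ → ℕ} (hx : memSigma M x) : reflSeq M (reflSeq M x) = x :=
  funext fun i => Nat.sub_sub_self (hx i)

lemma lexLE_reflSeq_comm {M : ℕ} {x y : ℕ → ℕ} (hx : memSigma M x) (hy : memSigma M y)
    (h : lexLE (reflSeq M x) y) : lexLE (reflSeq M y) x := by
  rcases h with rfl | ⟨d, h1, h2⟩
  · exact Or.inl (reflSeq_reflSeq hx)
  · refine Or.inr ⟨d, fun e he => ?_, ?_⟩
    · have := h1 e he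
      have := hx e
      simp only [reflSeq] at *
      omega
    · have := hx d
      have := hy d
      simp only [reflSeq] at h2 ⊢
      omega

lemma memV_of_forall_shift_le {M : ℕ} {x : ℕ → ℕ} (hx : memSigma M x)
    (h : ∀ n, lexLE (shift^[n] x) x ∧ lexLE (reflSeq M (shift^[n] x)) x) : memV M x :=
  ⟨hx, fun n => ⟨lexLE_reflSeq_comm (fun i => by rw [shift_iterate_apply]; exact hx _) hx (h n).2,
    (h n).1⟩⟩

lemma memV_of_periodic {M p : ℕ} (hp : 0 < p) {x : ℕ → ℕ} (hx : memSigma M x)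
    (hper : ∀ i, x (p + i) = x i)
    (h : ∀ n < p, lexLE (shift^[n] x) x ∧ lexLE (reflSeq M (shift^[n] x)) x) : memV M x := by
  refine memV_of_forall_shift_le hx fun n => ?_
  have hfix : shift^[p] x = x := funext fun i => by rw [shift_iterate_apply, hper]
  have hmod : shift^[n] x = shift^[n % p] x := by
    conv_lhs => rw [← Nat.mod_add_div n p, Function.iterate_add_apply, Function.iterate_mul,
      Function.iterate_fixed hfix]
  rw [hmod]
  exact h _ (Nat.mod_lt _ hp)

lemma lexLE_reflSeq_self {M : ℕ} (hM : 1 ≤ M) {x : ℕ → ℕ} (h0 : x 0 = M) :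
    lexLE (reflSeq M x) x :=
  Or.inr ⟨0, by simp, by simp only [reflSeq, h0]; omega⟩

/-! ### A family of weakly irreducible sequences -/

/-- The length of the `k`-th block. -/
def blockLen : ℕ → ℕ
  | 0 => 5
  | k + 1 => 2 * blockLen k + 5

/-- The blocks `w₀ = M M M 0 1` and `wₖ₊₁ = wₖ \overline{wₖ}⁺ 0 cₖ M 0 1`; only the first
`blockLen k` letters of the `k`-th sequence matter. -/
def blockWord (M : ℕ) (c : ℕ → ℕ) : ℕ → ℕ → ℕ
  | 0, i => if i < 3 then M else if i = 3 then 0 else 1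
  | k + 1, i =>
    if i < blockLen k then blockWord M c k i
    else if i < 2 * blockLen k - 1 then M - blockWord M c k (i - blockLen k)
    else if i = 2 * blockLen k - 1 then M
    else if i = 2 * blockLen k then 0
    else if i = 2 * blockLen k + 1 then c k
    else if i = 2 * blockLen k + 2 then M
    else if i = 2 * blockLen k + 3 then 0
    else 1

/-- The sequence having all the blocks as prefixes. -/
def blockSeq (M : ℕ) (c : ℕ → ℕ) (i : ℕ) : ℕ := blockWord M c i i

lemma five_le_blockLen (k : ℕ) : 5 ≤ blockLen k := by
  cases k <;> simp [blockLen]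

lemma lt_blockLen (k : ℕ) : k < blockLen k := by
  induction k with
  | zero => simp [blockLen]
  | succ k ih => simp only [blockLen]; omega

lemma blockWord_add (M : ℕ) (c : ℕ → ℕ) {k i : ℕ} (h : i < blockLen k) (m : ℕ) :
    blockWord M c (k + m) i = blockWord M c k i := by
  have hlt : ∀ m, i < blockLen (k + m) := by
    intro m
    induction m with
    | zero => exact h
    | succ m ih => rw [← add_assoc, blockLen]; omega
  induction m with
  | zero => rfl
  | succ m ih => rw [← add_assoc, blockWord, if_pos (hlt m), ih]

lemma blockSeq_eq (M : ℕ) (c : ℕ → ℕ) {k i : ℕ} (h : i < blockLen k) :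
    blockSeq M c i = blockWord M c k i := by
  rw [blockSeq]
  rcases le_total k i with hki | hki
  · obtain ⟨m, hm⟩ := Nat.exists_eq_add_of_le hki
    have := blockWord_add M c h m
    rwa [← hm] at this
  · obtain ⟨m, hm⟩ := Nat.exists_eq_add_of_le hki
    rw [hm, blockWord_add M c (lt_blockLen i)]

/-- The equations characterising `blockSeq M c`. -/
structure IsBlockSeq (M : ℕ) (c a : ℕ → ℕ) : Prop where
  zero : a 0 = M
  one : a 1 = M
  two : a 2 = M
  three : a 3 = 0
  four : a 4 = 1
  reflect : ∀ k i, i + 1 < blockLen k → a (blockLen k + i) = M - a i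
  reflect_last : ∀ k, a (2 * blockLen k - 1) = M
  tail_zero : ∀ k, a (2 * blockLen k) = 0
  tail_one : ∀ k, a (2 * blockLen k + 1) = c k
  tail_two : ∀ k, a (2 * blockLen k + 2) = M
  tail_three : ∀ k, a (2 * blockLen k + 3) = 0
  tail_four : ∀ k, a (2 * blockLen k + 4) = 1

lemma isBlockSeq_blockSeq (M : ℕ) (c : ℕ → ℕ) : IsBlockSeq M c (blockSeq M c) := by
  have h0 : ∀ i < 5, blockSeq M c i = blockWord M c 0 i := fun i hi => blockSeq_eq M c hi
  have hs : ∀ k i, i < 2 * blockLen k + 5 → blockSeq M c i = blockWord M c (k + 1) i :=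
    fun k i hi => blockSeq_eq M c hi
  refine ⟨?_, ?_, ?_, ?_, ?_, fun k i hi => ?_, fun k => ?_, fun k => ?_, fun k => ?_, fun k => ?_,
    fun k => ?_, fun k => ?_⟩
  iterate 5 rw [h0 _ (by norm_num)]; rfl
  · rw [hs k _ (by omega), blockSeq_eq M c (show i < blockLen k by omega), blockWord,
      if_neg (by omega), if_pos (by omega), Nat.add_sub_cancel_left]
  all_goals
    have := five_le_blockLen k
    rw [hs k _ (by omega), blockWord]
    repeat rw [if_neg (by omega)]
  iterate 5 rw [if_pos (by omega)]

namespace IsBlockSeq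

variable {M : ℕ} {c a : ℕ → ℕ}

lemma block_end (h : IsBlockSeq M c a) (k : ℕ) :
    a (blockLen k - 3) = M ∧ a (blockLen k - 2) = 0 ∧ a (blockLen k - 1) = 1 := by
  cases k with
  | zero => exact ⟨h.two, h.three, h.four⟩
  | succ k => exact ⟨h.tail_two k, h.tail_three k, h.tail_four k⟩

lemma memSigma (h : IsBlockSeq M c a) (hM : 1 ≤ M) (hc : ∀ k, c k = 0 ∨ c k = M) :
    memSigma M a := by
  have key : ∀ k, ∀ i < blockLen k, a i ≤ M := by
    intro k
    induction k with
    | zero =>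
      intro i hi
      simp only [blockLen] at hi
      have := h.zero; have := h.one; have := h.two; have := h.three; have := h.four
      interval_cases i <;> omega
    | succ k ih =>
      intro i hi
      simp only [blockLen] at hi
      by_cases h1 : i < blockLen k
      · exact ih i h1
      by_cases h2 : i < 2 * blockLen k - 1
      · have := h.reflect k (i - blockLen k) (by omega)
        rw [Nat.add_sub_cancel' (by omega)] at this
        omega
      have e := h.reflect_last k
      have e0 := h.tail_zero k; have e1 := h.tail_one k; have e2 := h.tail_two k
      have e3 := h.tail_three k; have e4 := h.tail_four k
      have := hc k
      obtain rfl | rfl | rfl | rfl | rfl | rfl : i = 2 * blockLen k - 1 ∨ i = 2 * blockLen k ∨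
        i = 2 * blockLen k + 1 ∨ i = 2 * blockLen k + 2 ∨ i = 2 * blockLen k + 3 ∨
        i = 2 * blockLen k + 4 := by omega
      all_goals omega
  exact fun i => key i i (lt_blockLen i)

lemma dominated (h : IsBlockSeq M c a) (hM : 1 ≤ M) (hc : ∀ k, c k = 0 ∨ c k = M) (k : ℕ) :
    ∀ i, 0 < i → i + 3 ≤ blockLen k → Dominated M a i (blockLen k - 1) := by
  have h0 := h.zero
  have h1 := h.one
  have h2 := h.two
  induction k with
  | zero =>
    intro i hi hik
    have h3 := h.three
    simp only [blockLen] at hik ⊢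
    obtain rfl | rfl : i = 1 ∨ i = 2 := by omega
    all_goals
      refine Dominated.of_short h0 h1 h2 ?_ ?_ <;> simp only [Nat.reduceAdd] <;> omega
  | succ k ih =>
    intro i hi hik
    simp only [blockLen] at hik ⊢
    have hL := five_le_blockLen k
    have hck := hc k
    obtain ⟨b3, b2, b1⟩ := h.block_end k
    have e := h.reflect_last k
    have e0 := h.tail_zero k
    have e1 := h.tail_one k
    have e2 := h.tail_two k
    have e3 := h.tail_three k
    have r0 := h.reflect k 0 (by omega)
    have r1 := h.reflect k 1 (by omega)
    have rl := h.reflect k (blockLen k - 2) (by omega)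
    rw [add_zero] at r0
    rw [show blockLen k + (blockLen k - 2) = 2 * blockLen k - 2 by omega] at rl
    by_cases hi1 : i + 3 ≤ blockLen k
    · exact (ih i hi hi1).mono (by omega)
    by_cases hi2 : blockLen k < i ∧ i + 3 ≤ 2 * blockLen k
    · have := (ih (i - blockLen k) (by omega) (by omega)).reflect (y := a) (p := blockLen k)
        (h.memSigma hM hc) (fun _ _ => rfl) (fun j hj => h.reflect k j (by omega))
      rw [Nat.add_sub_cancel' (by omega)] at this
      exact this.mono (by omega)
    obtain hi | hi | rfl | hi | hi | rfl | rfl | rfl : i = blockLen k - 2 ∨ i = blockLen k - 1 ∨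
        i = blockLen k ∨ i = 2 * blockLen k - 2 ∨ i = 2 * blockLen k - 1 ∨ i = 2 * blockLen k ∨
        i = 2 * blockLen k + 1 ∨ i = 2 * blockLen k + 2 := by omega
    · have s1 : i + 1 = blockLen k - 1 := by omega
      refine Dominated.of_short h0 h1 h2 ?_ ?_ <;> rw [s1, hi] <;> omega
    · have s1 : i + 1 = blockLen k := by omega
      refine Dominated.of_short h0 h1 h2 ?_ ?_ <;> rw [s1, hi] <;> omega
    · refine ⟨⟨0, by omega, by simp, by rw [add_zero]; omega⟩,
        ⟨blockLen k - 1, by omega, fun j hj => ?_, ?_⟩⟩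
      · rw [h.reflect k j (by omega), Nat.sub_sub_self (h.memSigma hM hc j)]
      · rw [show blockLen k + (blockLen k - 1) = 2 * blockLen k - 1 by omega]
        omega
    · have s1 : i + 1 = 2 * blockLen k - 1 := by omega
      have s2 : i + 2 = 2 * blockLen k := by omega
      refine Dominated.of_short h0 h1 h2 ?_ ?_ <;> rw [s1, s2, hi] <;> omega
    · have s1 : i + 1 = 2 * blockLen k := by omega
      refine Dominated.of_short h0 h1 h2 ?_ ?_ <;> rw [s1, hi] <;> omega
    · refine Dominated.of_short h0 h1 h2 ?_ ?_ <;> omega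
    · refine Dominated.of_short h0 h1 h2 ?_ ?_ <;> simp only [add_assoc, Nat.reduceAdd] <;> omega
    · refine Dominated.of_short h0 h1 h2 ?_ ?_ <;> simp only [add_assoc, Nat.reduceAdd] <;> omega

lemma dominated_of_pos (h : IsBlockSeq M c a) (hM : 1 ≤ M) (hc : ∀ k, c k = 0 ∨ c k = M) {n : ℕ}
    (hn : 0 < n) : ∃ N, Dominated M a n N :=
  ⟨_, h.dominated hM hc (n + 3) n hn (lt_blockLen (n + 3)).le⟩

lemma memV (h : IsBlockSeq M c a) (hM : 1 ≤ M) (hc : ∀ k, c k = 0 ∨ c k = M) : memV M a := by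
  refine memV_of_forall_shift_le (h.memSigma hM hc) fun n => ?_
  rcases Nat.eq_zero_or_pos n with rfl | hn
  · exact ⟨Or.inl rfl, lexLE_reflSeq_self hM h.zero⟩
  · obtain ⟨N, hN⟩ := h.dominated_of_pos hM hc hn
    exact ⟨Or.inr hN.shift_lexLT, Or.inr hN.reflSeq_shift_lexLT⟩

lemma memV_perSeq_block (h : IsBlockSeq M c a) (hM : 1 ≤ M) (hc : ∀ k, c k = 0 ∨ c k = M)
    (k : ℕ) : _root_.memV M (perSeq (wMinus (prefixWord a (blockLen k)))) := by
  have hL := five_le_blockLen k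
  have hS := h.memSigma hM hc
  set L := blockLen k with hLdef
  set y := perSeq (wMinus (prefixWord a L))
  obtain ⟨b3, b2, b1⟩ := h.block_end k
  rw [← hLdef] at b1 b2 b3
  have hy : ∀ i, y i = if i % L = L - 1 then a (L - 1) - 1 else a (i % L) :=
    perSeq_wMinus_prefixWord a (by omega)
  have hper : ∀ i, y (L + i) = y i := fun i => by rw [hy, hy, Nat.add_mod_left]
  have hya : ∀ i < L - 1, y i = a i := fun i hi => by
    rw [hy, Nat.mod_eq_of_lt (by omega), if_neg (by omega)]
  have hyl : y (L - 1) = 0 := by rw [hy, Nat.mod_eq_of_lt (by omega), if_pos rfl, b1]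
  have y0 : y 0 = M := (hya 0 (by omega)).trans h.zero
  have y1 : y 1 = M := (hya 1 (by omega)).trans h.one
  have y2 : y 2 = M := (hya 2 (by omega)).trans h.two
  have yL : y L = M := (hper 0).trans y0
  have yl2 : y (L - 2) = 0 := (hya _ (by omega)).trans b2
  have hyS : _root_.memSigma M y := fun i => by
    rw [hy]
    split_ifs
    · omega
    · exact hS _
  refine memV_of_periodic (by omega) hyS hper fun n hn => ?_
  rcases Nat.eq_zero_or_pos n with rfl | hn0
  · exact ⟨Or.inl rfl, lexLE_reflSeq_self hM y0⟩
  suffices ∃ N, Dominated M y n N by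
    obtain ⟨N, hN⟩ := this
    exact ⟨Or.inr hN.shift_lexLT, Or.inr hN.reflSeq_shift_lexLT⟩
  by_cases hn3 : n + 3 ≤ L
  · exact ⟨_, (h.dominated hM hc k n hn0 hn3).congr hya⟩
  refine ⟨L + 1, ?_⟩
  obtain hn | hn : n = L - 2 ∨ n = L - 1 := by omega
  · have s1 : n + 1 = L - 1 := by omega
    have s2 : n + 2 = L := by omega
    refine Dominated.of_short y0 y1 y2 ?_ ?_ <;> rw [s1, s2, hn] <;> omega
  · have s1 : n + 1 = L := by omega
    refine Dominated.of_short y0 y1 y2 ?_ ?_ <;> rw [s1, hn] <;> omega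

lemma perSeq_double_block (h : IsBlockSeq M c a) (k : ℕ) :
    (∀ i, perSeq (wMinus (prefixWord a (2 * blockLen k))) (2 * blockLen k + i)
        = perSeq (wMinus (prefixWord a (2 * blockLen k))) i) ∧
      (∀ i < blockLen k, perSeq (wMinus (prefixWord a (2 * blockLen k))) i = a i) ∧
      ∀ i < blockLen k,
        perSeq (wMinus (prefixWord a (2 * blockLen k))) (blockLen k + i) = M - a i := by
  have hL := five_le_blockLen k
  obtain ⟨b3, b2, b1⟩ := h.block_end k
  have hy := fun i => perSeq_wMinus_prefixWord a (n := 2 * blockLen k) (by omega) i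
  refine ⟨fun i => by rw [hy, hy, Nat.add_mod_left], fun i hi => ?_, fun i hi => ?_⟩
  · rw [hy, Nat.mod_eq_of_lt (by omega), if_neg (by omega)]
  · rw [hy, Nat.mod_eq_of_lt (by omega)]
    split_ifs with hl
    · obtain rfl : i = blockLen k - 1 := by omega
      rw [h.reflect_last, b1]
    · exact h.reflect k i (by omega)

lemma memV_perSeq_double_block (h : IsBlockSeq M c a) (hM : 1 ≤ M)
    (hc : ∀ k, c k = 0 ∨ c k = M) (k : ℕ) :
    _root_.memV M (perSeq (wMinus (prefixWord a (2 * blockLen k)))) := by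
  have hL := five_le_blockLen k
  have hS := h.memSigma hM hc
  obtain ⟨hper, hya, hyr⟩ := h.perSeq_double_block k
  obtain ⟨b3, b2, b1⟩ := h.block_end k
  set L := blockLen k with hLdef
  set y := perSeq (wMinus (prefixWord a (2 * L)))
  have y0 : y 0 = M := (hya 0 (by omega)).trans h.zero
  have y1 : y 1 = M := (hya 1 (by omega)).trans h.one
  have y2 : y 2 = M := (hya 2 (by omega)).trans h.two
  have yl2 : y (L - 2) = 0 := (hya _ (by omega)).trans b2
  have yl1 : y (L - 1) = 1 := (hya _ (by omega)).trans b1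
  have yL : y L = 0 := by have := hyr 0 (by omega); rw [add_zero, h.zero] at this; omega
  have z2 : y (2 * L - 2) = M := by
    have := hyr (L - 2) (by omega)
    rwa [show L + (L - 2) = 2 * L - 2 by omega, b2] at this
  have z1 : y (2 * L - 1) = M - 1 := by
    have := hyr (L - 1) (by omega)
    rwa [show L + (L - 1) = 2 * L - 1 by omega, b1] at this
  have z0 : y (2 * L) = M := (hper 0).trans y0
  have hrefl : ∀ i, y (L + i) = M - y i := by
    have hlt : ∀ i < 2 * L, y (L + i) = M - y i := fun i hi => by
      by_cases hiL : i < L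
      · rw [hyr i hiL, hya i hiL]
      · obtain ⟨j, rfl⟩ := Nat.exists_eq_add_of_le (not_lt.mp hiL)
        rw [← add_assoc, ← two_mul, hper, hyr j (by omega), hya j (by omega),
          Nat.sub_sub_self (hS j)]
    have hmod : ∀ m i, y (2 * L * m + i) = y i := by
      intro m
      induction m with
      | zero => simp
      | succ m ih =>
        intro i
        rw [show 2 * L * (m + 1) + i = 2 * L + (2 * L * m + i) by ring, hper, ih]
    intro i
    rw [← Nat.div_add_mod i (2 * L), show ∀ s t, L + (s + t) = s + (L + t) by intros; ring,
      hmod, hmod, hlt _ (Nat.mod_lt _ (by omega))]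
  have hyS : _root_.memSigma M y := by
    have hlt : ∀ i < 2 * L, y i ≤ M := fun i hi => by
      by_cases hiL : i < L
      · rw [hya i hiL]
        exact hS i
      · obtain ⟨j, rfl⟩ := Nat.exists_eq_add_of_le (not_lt.mp hiL)
        rw [hrefl]
        exact Nat.sub_le _ _
    intro i
    induction i using Nat.strong_induction_on with
    | _ i ih =>
      by_cases hi : i < 2 * L
      · exact hlt i hi
      · obtain ⟨j, rfl⟩ := Nat.exists_eq_add_of_le (not_lt.mp hi)
        rw [hper]
        exact ih j (by omega)
  have hyrefl : shift^[L] y = reflSeq M y := funext fun i => by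
    rw [shift_iterate_apply, hrefl, reflSeq]
  refine memV_of_periodic (by omega) hyS hper fun n hn => ?_
  by_cases hn0 : n = 0
  · subst hn0
    exact ⟨Or.inl rfl, lexLE_reflSeq_self hM y0⟩
  by_cases hnL : n = L
  · subst hnL
    rw [hyrefl, reflSeq_reflSeq hyS]
    exact ⟨lexLE_reflSeq_self hM y0, Or.inl rfl⟩
  suffices ∃ N, Dominated M y n N by
    obtain ⟨N, hN⟩ := this
    exact ⟨Or.inr hN.shift_lexLT, Or.inr hN.reflSeq_shift_lexLT⟩
  by_cases hn1 : n + 3 ≤ L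
  · exact ⟨_, (h.dominated hM hc k n (by omega) hn1).congr fun i hi => hya i (by omega)⟩
  by_cases hn2 : L < n ∧ n + 3 ≤ 2 * L
  · have := (h.dominated hM hc k (n - L) (by omega) (by omega)).reflect (y := y) (p := L) hS
      (fun i hi => hya i (by omega)) (fun i hi => hyr i (by omega))
    rw [Nat.add_sub_cancel' (by omega)] at this
    exact ⟨_, this⟩
  refine ⟨2 * L + 1, ?_⟩
  obtain hn | hn | hn | hn : n = L - 2 ∨ n = L - 1 ∨ n = 2 * L - 2 ∨ n = 2 * L - 1 := by omega
  · have s1 : n + 1 = L - 1 := by omega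
    refine Dominated.of_short y0 y1 y2 ?_ ?_ <;> rw [s1, hn] <;> omega
  · have s1 : n + 1 = L := by omega
    refine Dominated.of_short y0 y1 y2 ?_ ?_ <;> rw [s1, hn] <;> omega
  · have s1 : n + 1 = 2 * L - 1 := by omega
    refine Dominated.of_short y0 y1 y2 ?_ ?_ <;> rw [s1, hn] <;> omega
  · have s1 : n + 1 = 2 * L := by omega
    refine Dominated.of_short y0 y1 y2 ?_ ?_ <;> rw [s1, hn] <;> omega

lemma not_irreducibleSeq_double_block (h : IsBlockSeq M c a) (hM : 1 ≤ M)
    (hc : ∀ k, c k = 0 ∨ c k = M) (k : ℕ) :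
    ¬ IrreducibleSeq M (perSeq (wMinus (prefixWord a (2 * blockLen k)))) := by
  intro hirr
  have hL := five_le_blockLen k
  obtain ⟨-, hya, hyr⟩ := h.perSeq_double_block k
  obtain ⟨-, -, b1⟩ := h.block_end k
  have hpre : prefixWord (perSeq (wMinus (prefixWord a (2 * blockLen k)))) (blockLen k)
      = prefixWord a (blockLen k) :=
    List.map_congr_left fun i hi => hya i (List.mem_range.mp hi)
  have hlt := hirr (blockLen k) (by omega) (by rw [hpre]; exact h.memV_perSeq_block hM hc k)
  rw [hpre] at hlt
  refine lexLT_asymm hlt ⟨2 * blockLen k - 1, fun i hi => ?_, ?_⟩ <;>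
    rw [wordThenPer_prefixWord M a (by omega)]
  · split_ifs with h1 h2
    · exact hya i h1
    · rw [Nat.mod_eq_of_lt (by omega)] at h2
      omega
    · obtain ⟨j, rfl⟩ := Nat.exists_eq_add_of_le (not_lt.mp h1)
      rw [hyr j (by omega), Nat.add_sub_cancel_left, Nat.mod_eq_of_lt (by omega)]
  · have e : 2 * blockLen k - 1 = blockLen k + (blockLen k - 1) := by omega
    rw [e, hyr _ (by omega), if_neg (by omega), Nat.add_sub_cancel_left,
      Nat.mod_eq_of_lt (by omega), if_pos rfl]
    omega

lemma lexLT_of_pos (h : IsBlockSeq M c a) {j : ℕ} (hj : 4 ≤ j)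
    (hpos : 0 < a j ∨ 0 < a (j + 1) ∨ 0 < a (j + 2)) :
    lexLT (wordThenPer (prefixWord a j) (wPlus (wRefl M (prefixWord a j)))) a := by
  have hw := wordThenPer_prefixWord M a (n := j) (by omega)
  have hlow : ∀ i < j, wordThenPer (prefixWord a j) (wPlus (wRefl M (prefixWord a j))) i = a i :=
    fun i hi => by rw [hw, if_pos hi]
  have hhigh : ∀ d < 3,
      wordThenPer (prefixWord a j) (wPlus (wRefl M (prefixWord a j))) (j + d) = 0 := by
    intro d hd
    rw [hw, if_neg (by omega), Nat.add_sub_cancel_left, Nat.mod_eq_of_lt (by omega),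
      if_neg (by omega)]
    have := h.zero
    have := h.one
    have := h.two
    interval_cases d <;> omega
  have u0 := hhigh 0 (by norm_num)
  have u1 := hhigh 1 (by norm_num)
  have u2 := hhigh 2 (by norm_num)
  rw [add_zero] at u0
  by_cases p0 : 0 < a j
  · exact ⟨j, hlow, by omega⟩
  by_cases p1 : 0 < a (j + 1)
  · refine ⟨j + 1, fun i hi => ?_, by omega⟩
    by_cases hij : i < j
    · exact hlow i hij
    · obtain rfl : i = j := by omega
      omega
  · refine ⟨j + 2, fun i hi => ?_, by omega⟩
    by_cases hij : i < j
    · exact hlow i hij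
    · obtain rfl | rfl : i = j ∨ i = j + 1 := by omega
      all_goals omega

lemma irreducibleSeq (h : IsBlockSeq M c a) (hM : 1 ≤ M) (hc : ∀ k, c k = 0 ∨ c k = M) :
    IrreducibleSeq M a := by
  have hS := h.memSigma hM hc
  have a0 := h.zero
  have a1 := h.one
  have a2 := h.two
  have a3 := h.three
  have a4 := h.four
  intro j hj hV
  by_cases hj5 : j < 5
  · have hw := wordThenPer_prefixWord M a (n := j) hj
    interval_cases j
    · have hM2 : 2 ≤ M := by
        by_contra hcon
        obtain rfl : M = 1 := by omega
        have hz : perSeq (wMinus (prefixWord a 1)) = fun _ => 0 := funext fun i => by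
          rw [perSeq_wMinus_prefixWord a le_rfl, if_pos (by omega)]
          simp [a0]
        rw [hz] at hV
        rcases (hV.2 0).1 with heq | ⟨d, -, hd⟩
        · simpa [reflSeq] using congrFun heq 0
        · simp at hd
      refine ⟨1, fun i hi => ?_, ?_⟩ <;> rw [hw]
      · rw [if_pos hi]
      · simp [a0, a1]
        omega
    · refine ⟨2, fun i hi => ?_, ?_⟩ <;> rw [hw]
      · rw [if_pos hi]
      · simp [a0, a2]
        omega
    · refine ⟨4, fun i hi => ?_, ?_⟩ <;> rw [hw]
      · interval_cases i <;> simp [a0, a3]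
      · simp [a1, a4]
    · exact h.lexLT_of_pos le_rfl (Or.inl (by omega))
  have hex : ∃ k, j < blockLen (k + 1) := ⟨j, (lt_blockLen j).trans (by simp only [blockLen]; omega)⟩
  obtain ⟨k, hlow, hhigh⟩ : ∃ k, blockLen k ≤ j ∧ j < 2 * blockLen k + 5 := by
    refine ⟨Nat.find hex, ?_, Nat.find_spec hex⟩
    rcases hk : Nat.find hex with _ | k
    · simp only [blockLen]
      omega
    · exact not_lt.mp (Nat.find_min hex (by omega))
  have hL := five_le_blockLen k
  obtain ⟨b3, b2, b1⟩ := h.block_end k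
  have e := h.reflect_last k
  have e0 := h.tail_zero k
  have e1 := h.tail_one k
  have e2 := h.tail_two k
  have e4 := h.tail_four k
  have hw := wordThenPer_prefixWord M a (n := j) hj
  rcases hlow.eq_or_lt with rfl | hlow
  · have hagree : ∀ i < 2 * blockLen k, wordThenPer (prefixWord a (blockLen k))
        (wPlus (wRefl M (prefixWord a (blockLen k)))) i = a i := fun i hi => by
      rw [hw]
      split_ifs with h1 h2
      · rfl
      · rw [Nat.mod_eq_of_lt (by omega)] at h2
        rw [show i = 2 * blockLen k - 1 by omega]
        omega
      · obtain ⟨i, rfl⟩ := Nat.exists_eq_add_of_le (not_lt.mp h1)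
        rw [Nat.add_sub_cancel_left, Nat.mod_eq_of_lt (by omega)] at h2 ⊢
        exact (h.reflect k i (by omega)).symm
    have hnext : ∀ d < 3, wordThenPer (prefixWord a (blockLen k))
        (wPlus (wRefl M (prefixWord a (blockLen k)))) (2 * blockLen k + d) = 0 := fun d hd => by
      rw [hw, if_neg (by omega), show 2 * blockLen k + d - blockLen k = blockLen k + d by omega,
        Nat.add_mod_left, Nat.mod_eq_of_lt (by omega), if_neg (by omega)]
      interval_cases d <;> omega
    have u0 := hnext 0 (by norm_num)
    have u1 := hnext 1 (by norm_num)
    have u2 := hnext 2 (by norm_num)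
    rw [add_zero] at u0
    rcases hc k with hck | hck
    · refine ⟨2 * blockLen k + 2, fun i hi => ?_, by omega⟩
      by_cases hi' : i < 2 * blockLen k
      · exact hagree i hi'
      · obtain rfl | rfl : i = 2 * blockLen k ∨ i = 2 * blockLen k + 1 := by omega
        all_goals omega
    · refine ⟨2 * blockLen k + 1, fun i hi => ?_, by omega⟩
      by_cases hi' : i < 2 * blockLen k
      · exact hagree i hi'
      · obtain rfl : i = 2 * blockLen k := by omega
        omega
  by_cases hin : j + 3 ≤ 2 * blockLen k
  · obtain ⟨⟨d, hd, h1, h2⟩, -⟩ := h.dominated hM hc k (j - blockLen k) (by omega) (by omega)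
    have hr : ∀ i ≤ d, a (j + i) = M - a (j - blockLen k + i) := fun i hi => by
      rw [← h.reflect k _ (by omega), show blockLen k + (j - blockLen k + i) = j + i by omega]
    have hv : ∀ i ≤ d, wordThenPer (prefixWord a j) (wPlus (wRefl M (prefixWord a j))) (j + i)
        = M - a i := fun i hi => by
      rw [hw, if_neg (by omega), Nat.add_sub_cancel_left, Nat.mod_eq_of_lt (by omega),
        if_neg (by omega)]
    refine ⟨j + d, fun i hi => ?_, ?_⟩
    · by_cases hij : i < j
      · rw [hw, if_pos hij]
      · obtain ⟨i, rfl⟩ := Nat.exists_eq_add_of_le (not_lt.mp hij)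
        rw [hv i (by omega), hr i (by omega), h1 i (by omega)]
    · rw [hv d le_rfl, hr d le_rfl]
      have := hS d
      omega
  have rl := h.reflect k (blockLen k - 2) (by omega)
  rw [show blockLen k + (blockLen k - 2) = 2 * blockLen k - 2 by omega] at rl
  refine h.lexLT_of_pos (by omega) ?_
  obtain rfl | rfl | rfl | rfl | rfl | rfl | rfl : j = 2 * blockLen k - 2 ∨
    j = 2 * blockLen k - 1 ∨ j = 2 * blockLen k ∨ j = 2 * blockLen k + 1 ∨
    j = 2 * blockLen k + 2 ∨ j = 2 * blockLen k + 3 ∨ j = 2 * blockLen k + 4 := by omega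
  all_goals
    try simp only [add_assoc, Nat.reduceAdd]
    omega

lemma exists_memWI (h : IsBlockSeq M c a) (hM : 1 ≤ M) (hc : ∀ k, c k = 0 ∨ c k = M) :
    ∃ q, memWI M q ∧ qg M q = a := by
  have hV := h.memV hM hc
  obtain ⟨q, hq, hqM, hqa⟩ := exists_base_qg_eq hM hV.1 (by rw [h.zero]; omega)
    (by rw [h.one]; omega)
    (fun n => ⟨2 * blockLen n + 2, by have := lt_blockLen n; omega, by rw [h.tail_two]; omega⟩)
    (fun n => (hV.2 n).2)
  refine ⟨q, ?_, hqa⟩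
  refine memWI_of_infinitely_many_reducible ⟨⟨hq, hqM, hqa ▸ hV⟩, hqa ▸ h.irreducibleSeq hM hc⟩
    fun N => ⟨2 * blockLen N, ⟨?_, ?_⟩, ?_, ?_⟩
  · have := lt_blockLen N
    omega
  · rw [hqa]
    exact h.memV_perSeq_double_block hM hc N
  · have := lt_blockLen N
    omega
  · rw [hqa]
    exact h.not_irreducibleSeq_double_block hM hc N

end IsBlockSeq

/-- The set of weakly irreducible bases is uncountable. -/
theorem WI_uncountable (M : ℕ) (hM : 1 ≤ M) :
    ¬ ({q : ℝ | memWI M q}).Countable := by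
  intro hcount
  let c : (ℕ → Bool) → ℕ → ℕ := fun s k => if s k then M else 0
  have hc : ∀ s k, c s k = 0 ∨ c s k = M := fun s k => by
    by_cases hs : s k <;> simp [c, hs]
  have hinj : Function.Injective fun s : ℕ → Bool => blockSeq M (c s) := by
    intro s t hst
    funext k
    have hk := congrFun hst (2 * blockLen k + 1)
    simp only [(isBlockSeq_blockSeq M _).tail_one] at hk
    by_cases hs : s k <;> by_cases ht : t k <;> simp_all [c]; omega
  have hrange : (Set.range fun s : ℕ → Bool => blockSeq M (c s)).Countable := by
    refine (hcount.image (qg M)).mono ?_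
    rintro _ ⟨s, rfl⟩
    exact (isBlockSeq_blockSeq M (c s)).exists_memWI hM (hc s)
  have huniv : (Set.univ : Set (ℕ → Bool)).Countable := by
    rw [← Set.image_univ] at hrange
    exact Set.countable_of_injective_of_countable_image hinj.injOn hrange
  have := Set.countable_univ_iff.mp huniv
  obtain ⟨f, hf⟩ := exists_surjective_nat (ℕ → Bool)
  obtain ⟨n, hn⟩ := hf fun k => !f k k
  simpa using congrFun hn n
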